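/- Assume the covering setup with m ≤ 5. Then min{g_1, …, g_m} = 1; that is, at least one p_k is relatively prime to q. -/

import Mathlib

/-- The Beatty multiplicity function `B_{p,r}^q(x) := #{n ∈ ℤ : ⌊nq/p + r⌋ = x}`. -/
noncomputable def beattyCount (p q r x : ℤ) : ℕ :=
  {n : ℤ | ⌊((n : ℚ) * q / p + r)⌋ = x}.ncard

open Finset

theorem beattyCount_eq_ite {p q : ℤ} (hp : 0 < p) (hpq : p < q) (r x : ℤ) :
    beattyCount p q r x = if (p * (r - x)) % q < p then 1 else 0 := by
  have hq : 0 < q := hp.trans hpq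
  have hmem (n : ℤ) : ⌊((n : ℚ) * q / p + r)⌋ = x ↔
      p * (x - r) ≤ n * q ∧ n * q < p * (x - r) + p := by
    have hp' : (0 : ℚ) < p := by exact_mod_cast hp
    have h : ((n : ℚ) * q / p + r) = (n * q + r * p) / p := by field_simp
    rw [h, Int.floor_eq_iff, le_div_iff₀ hp', div_lt_iff₀ hp']
    norm_cast
    constructor <;> rintro ⟨h1, h2⟩ <;> constructor <;> linarith
  have hdiv := Int.emod_add_mul_ediv (p * (r - x)) q
  have h0 := Int.emod_nonneg (p * (r - x)) hq.ne'
  have h1 := Int.emod_lt_of_pos (p * (r - x)) hq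
  set t := (p * (r - x)) % q
  set e := (p * (r - x)) / q
  have key (n : ℤ) (hn : p * (x - r) ≤ n * q ∧ n * q < p * (x - r) + p) : n = -e ∧ t < p := by
    have h2 : n + e < 1 := by
      by_contra! h
      nlinarith
    have h3 : -1 < n + e := by
      by_contra! h
      nlinarith
    obtain rfl : n = -e := by omega
    exact ⟨rfl, by linarith⟩
  unfold beattyCount
  simp only [hmem]
  split_ifs with h
  · rw [Set.ncard_eq_one]
    refine ⟨-e, Set.ext fun n => ⟨fun hn => (key n hn).1, ?_⟩⟩
    rintro rfl
    constructor <;> linarith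
  · convert Set.ncard_empty ℤ
    exact Set.eq_empty_of_forall_notMem fun n hn => h (key n hn).2

theorem Function.Periodic.sum_range_add_int {M : Type*} [AddCommMonoid M] {f : ℤ → M} {n : ℕ}
    (hf : Function.Periodic f (n : ℤ)) (a : ℤ) :
    ∑ x ∈ range n, f (x + a) = ∑ x ∈ range n, f x := by
  have step (b : ℤ) : ∑ x ∈ range n, f (x + (b + 1)) = ∑ x ∈ range n, f (x + b) := by
    have h := (sum_range_succ' (fun x : ℕ => f (x + b)) n).symm.trans
      (sum_range_succ (fun x : ℕ => f (x + b)) n)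
    cases n with
    | zero => simp
    | succ n =>
      rw [sum_range_succ, sum_range_succ' (fun x : ℕ => f (x + b))]
      congr 1
      · exact sum_congr rfl fun x _ => by push_cast; congr 1; ring
      · rw [← hf (((0 : ℕ) : ℤ) + b)]
        push_cast
        congr 1
        ring
  induction a using Int.induction_on with
  | zero => simp
  | succ a ih => rw [step, ih]
  | pred a ih => rw [← ih, ← step (-a - 1), sub_add_cancel]

/-- The indicator function of the Beatty sequence `⌊n * d / p + r⌋`. -/
def beattyIndicator (p d r x : ℤ) : ℂ := if (p * (r - x)) % d < p then 1 else 0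

theorem beattyCount_mul_mul {g p d : ℤ} (hg : 0 < g) (hp : 0 < p) (hpd : p < d) (r x : ℤ) :
    (beattyCount (g * p) (g * d) r x : ℂ) = beattyIndicator p d r x := by
  rw [beattyCount_eq_ite (by positivity) (by gcongr), beattyIndicator, mul_assoc,
    Int.mul_emod_mul_of_pos _ _ hg]
  simp only [mul_lt_mul_iff_right₀ hg]
  split_ifs <;> simp

theorem beattyIndicator_periodic (p d r : ℤ) : Function.Periodic (beattyIndicator p d r) d := by
  intro x
  have : p * (r - (x + d)) = p * (r - x) + d * (-p) := by ring
  rw [beattyIndicator, beattyIndicator, this, Int.add_mul_emod_self_left]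

theorem sum_mul_zpow_shift {f : ℤ → ℂ} {n : ℕ} (hf : Function.Periodic f (n : ℤ)) {ζ : ℂ}
    (h0 : ζ ≠ 0) (hζ : ζ ^ n = 1) (a : ℤ) :
    ζ ^ a * ∑ x ∈ range n, f x * ζ ^ (x : ℤ) =
      ∑ x ∈ range n, f (x - a) * ζ ^ (x : ℤ) := by
  have hper : Function.Periodic (fun x => f (x - a) * ζ ^ x) (n : ℤ) := by
    intro x
    simp only [zpow_add₀ h0, zpow_natCast, hζ, mul_one, add_sub_right_comm, hf (x - a)]
  rw [← hper.sum_range_add_int a, mul_sum]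
  refine sum_congr rfl fun x _ => ?_
  simp only [zpow_add₀ h0, add_sub_cancel_right]
  ring

theorem sum_beattyIndicator_eq_zero (p r : ℤ) {e n : ℕ} (hen : e ∣ n) {ζ : ℂ}
    (h0 : ζ ≠ 0) (hζ : ζ ^ n = 1) (he : ζ ^ e ≠ 1) :
    ∑ x ∈ range n, beattyIndicator p e r x * ζ ^ (x : ℤ) = 0 := by
  have hf := beattyIndicator_periodic p e r
  have hper : Function.Periodic (beattyIndicator p e r) (n : ℤ) := by
    obtain ⟨k, rfl⟩ := hen
    have := hf.nat_mul k
    push_cast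
    rwa [mul_comm]
  have h := sum_mul_zpow_shift hper h0 hζ e
  simp only [hf.sub_eq, zpow_natCast] at h
  simp only [zpow_natCast]
  by_contra hne
  exact he (mul_right_cancel₀ hne (h.trans (one_mul _).symm))

theorem beattyIndicator_sub_inverse {p d s : ℤ} (hp : 0 < p) (hpd : p < d) (hs : d ∣ p * s - 1)
    (r x : ℤ) :
    beattyIndicator p d r (x - s) - beattyIndicator p d r x =
      (if d ∣ x - (r + s) then 1 else 0) - (if d ∣ x - (r + s - 1) then 1 else 0) := by
  have hd : 0 < d := hp.trans hpd
  have hcop : IsCoprime d p := by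
    obtain ⟨k, hk⟩ := hs
    exact ⟨-k, s, by linarith⟩
  have hdvd (y : ℤ) : d ∣ y ↔ d ∣ p * y := ⟨fun h => h.mul_left _, hcop.dvd_of_dvd_mul_left⟩
  set t := (p * (r - x)) % d with ht
  have h0 : 0 ≤ t := Int.emod_nonneg _ hd.ne'
  have h1 : t < d := Int.emod_lt_of_pos _ hd
  have hdt : d ∣ p * (r - x) - t := Int.dvd_self_sub_emod
  have hshift : (p * (r - (x - s))) % d = (t + 1) % d := by
    rw [Int.emod_eq_emod_iff_emod_sub_eq_zero, ← Int.dvd_iff_emod_eq_zero]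
    have : p * (r - (x - s)) - (t + 1) = (p * (r - x) - t) + (p * s - 1) := by ring
    rw [this]
    exact hdt.add hs
  have e1 : d ∣ x - (r + s) ↔ t = d - 1 := by
    have : p * (x - (r + s)) = (d - 1 - t) - ((p * (r - x) - t) + (p * s - 1) + d) := by ring
    rw [hdvd, this, dvd_sub_left ((hdt.add hs).add (dvd_refl d))]
    refine ⟨fun h => ?_, fun h => by simp [h]⟩
    have := Int.eq_zero_of_abs_lt_dvd h (by rw [abs_lt]; omega)
    omega
  have e2 : d ∣ x - (r + s - 1) ↔ t = p - 1 := by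
    have : p * (x - (r + s - 1)) = (p - 1 - t) - ((p * (r - x) - t) + (p * s - 1)) := by ring
    rw [hdvd, this, dvd_sub_left (hdt.add hs)]
    refine ⟨fun h => ?_, fun h => by simp [h]⟩
    have := Int.eq_zero_of_abs_lt_dvd h (by rw [abs_lt]; omega)
    omega
  simp only [beattyIndicator, hshift, e1, e2, ← ht]
  by_cases htd : t = d - 1
  · have h2 : t ≠ p - 1 := by omega
    have h3 : ¬ t < p := by omega
    rw [if_neg h2, if_neg h3, if_pos htd, htd, sub_add_cancel, Int.emod_self, if_pos hp]
  · rw [Int.emod_eq_of_lt (by omega : 0 ≤ t + 1) (by omega)]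
    split_ifs <;> first | omega | simp

theorem sum_dvd_sub_mul_zpow {d n : ℕ} (hdn : d ∣ n) {ζ : ℂ} (h0 : ζ ≠ 0) (hζ : ζ ^ d = 1)
    (a : ℤ) :
    ∑ x ∈ range n, (if (d : ℤ) ∣ x - a then 1 else 0) * ζ ^ (x : ℤ) =
      #{x ∈ range n | d ∣ x} * ζ ^ a := by
  have hper : Function.Periodic (fun x : ℤ => if (d : ℤ) ∣ x then (1 : ℂ) else 0) (n : ℤ) := by
    intro x
    simp only [dvd_add_left (Int.natCast_dvd_natCast.mpr hdn)]
  have hn : ζ ^ n = 1 := by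
    obtain ⟨k, rfl⟩ := hdn
    rw [pow_mul, hζ, one_pow]
  rw [← sum_mul_zpow_shift hper h0 hn a, mul_comm, natCast_card_filter]
  congr 1
  refine sum_congr rfl fun x _ => ?_
  split_ifs with h h' h'
  · obtain ⟨k, rfl⟩ := Int.natCast_dvd_natCast.mp h
    simp [zpow_mul, hζ]
  · exact absurd (Int.natCast_dvd_natCast.mp h) h'
  · exact absurd (Int.natCast_dvd_natCast.mpr h') h
  · simp

theorem norm_sum_beattyIndicator {p s r : ℤ} {d n : ℕ} (hp : 0 < p) (hpd : p < d)
    (hs : (d : ℤ) ∣ p * s - 1) (hdn : d ∣ n) {ζ : ℂ} (hζ : IsPrimitiveRoot ζ d) :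
    ‖ζ ^ s - 1‖ * ‖∑ x ∈ range n, beattyIndicator p d r x * ζ ^ (x : ℤ)‖ =
      #{x ∈ range n | d ∣ x} * ‖ζ - 1‖ := by
  have hd : d ≠ 0 := by omega
  have h0 : ζ ≠ 0 := hζ.ne_zero hd
  have hn : ζ ^ n = 1 := by
    obtain ⟨k, rfl⟩ := hdn
    rw [pow_mul, hζ.pow_eq_one, one_pow]
  have hnorm : ‖ζ‖ = 1 := hζ.norm'_eq_one hd
  have hper : Function.Periodic (beattyIndicator p d r) (n : ℤ) := by
    obtain ⟨k, rfl⟩ := hdn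
    have := (beattyIndicator_periodic p d r).nat_mul k
    push_cast
    rwa [mul_comm]
  have key : (ζ ^ s - 1) * ∑ x ∈ range n, beattyIndicator p d r x * ζ ^ (x : ℤ) =
      #{x ∈ range n | d ∣ x} * (ζ ^ (r + s - 1) * (ζ - 1)) := by
    rw [sub_mul, sum_mul_zpow_shift hper h0 hn, one_mul, ← sum_sub_distrib]
    simp only [← sub_mul, beattyIndicator_sub_inverse hp hpd hs]
    simp only [sub_mul, sum_sub_distrib]
    rw [sum_dvd_sub_mul_zpow hdn h0 hζ.pow_eq_one, sum_dvd_sub_mul_zpow hdn h0 hζ.pow_eq_one,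
      zpow_sub_one₀ h0]
    field_simp
  rw [← norm_mul, key, norm_mul, norm_mul, norm_zpow, hnorm, one_zpow, one_mul,
    Complex.norm_natCast]

theorem Complex.eq_or_mul_eq_one_of_norm_sub_one_eq {z w : ℂ} (hz : ‖z‖ = 1) (hw : ‖w‖ = 1)
    (h : ‖z - 1‖ = ‖w - 1‖) : z = w ∨ z * w = 1 := by
  have hz' : z.re * z.re + z.im * z.im = 1 := by
    rw [← Complex.normSq_apply, Complex.normSq_eq_norm_sq, hz, one_pow]
  have hw' : w.re * w.re + w.im * w.im = 1 := by
    rw [← Complex.normSq_apply, Complex.normSq_eq_norm_sq, hw, one_pow]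
  have h2 : Complex.normSq (z - 1) = Complex.normSq (w - 1) := by
    rw [Complex.normSq_eq_norm_sq, Complex.normSq_eq_norm_sq, h]
  simp only [Complex.normSq_apply, Complex.sub_re, Complex.sub_im, Complex.one_re,
    Complex.one_im] at h2
  have hre : z.re = w.re := by linarith
  have him : z.im * z.im = w.im * w.im := by rw [hre] at hz'; linarith
  rcases mul_self_eq_mul_self_iff.mp him with him | him
  · exact Or.inl (Complex.ext hre him)
  · right
    apply Complex.ext <;> simp only [Complex.mul_re, Complex.mul_im, hre, him, Complex.one_re,
      Complex.one_im] <;> linarith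

/-- Two Beatty sequences of the same reduced denominator `d` whose Fourier coefficients at a
primitive `d`-th root of unity cancel have equal or complementary slopes. -/
theorem eq_or_add_eq_of_sum_beattyIndicator_add_eq_zero {p p' r r' : ℤ} {d n : ℕ}
    (hp : 0 < p) (hpd : p < d) (hp' : 0 < p') (hpd' : p' < d)
    (hc : IsCoprime p d) (hc' : IsCoprime p' d)
    (hdn : d ∣ n) {ζ : ℂ} (hζ : IsPrimitiveRoot ζ d)
    (hne : ∑ x ∈ range n, beattyIndicator p d r x * ζ ^ (x : ℤ) ≠ 0)
    (h : ∑ x ∈ range n, beattyIndicator p d r x * ζ ^ (x : ℤ) +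
      ∑ x ∈ range n, beattyIndicator p' d r' x * ζ ^ (x : ℤ) = 0) :
    p = p' ∨ p + p' = d := by
  obtain ⟨s, b, hs⟩ := hc
  obtain ⟨s', b', hs'⟩ := hc'
  have hs1 : (d : ℤ) ∣ p * s - 1 := ⟨-b, by linarith⟩
  have hs1' : (d : ℤ) ∣ p' * s' - 1 := ⟨-b', by linarith⟩
  have hd : d ≠ 0 := by omega
  have hnorm : ‖ζ‖ = 1 := hζ.norm'_eq_one hd
  have h1 := norm_sum_beattyIndicator (r := r) hp hpd hs1 hdn hζ
  have h2 := norm_sum_beattyIndicator (r := r') hp' hpd' hs1' hdn hζ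
  rw [← neg_eq_of_add_eq_zero_right h, norm_neg, ← h1] at h2
  have h3 := mul_right_cancel₀ (norm_ne_zero_iff.mpr hne) h2
  rcases Complex.eq_or_mul_eq_one_of_norm_sub_one_eq (by simp [hnorm]) (by simp [hnorm]) h3
    with h4 | h4
  · left
    have h5 : (d : ℤ) ∣ s' - s := by
      rw [← hζ.zpow_eq_one_iff_dvd, zpow_sub₀ (hζ.ne_zero hd), h4,
        div_self (zpow_ne_zero _ (hζ.ne_zero hd))]
    have h6 : (d : ℤ) ∣ p - p' := by
      have : p - p' = p * p' * (s' - s) + p' * (p * s - 1) - p * (p' * s' - 1) := by ring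
      rw [this]
      exact ((h5.mul_left _).add (hs1.mul_left _)).sub (hs1'.mul_left _)
    have := Int.eq_zero_of_abs_lt_dvd h6 (by rw [abs_lt]; omega)
    omega
  · right
    have h5 : (d : ℤ) ∣ s' + s := by
      rw [← hζ.zpow_eq_one_iff_dvd, zpow_add₀ (hζ.ne_zero hd), h4]
    have h6 : (d : ℤ) ∣ p + p' - d := by
      have : p + p' - d =
          p * p' * (s' + s) - p' * (p * s - 1) - p * (p' * s' - 1) - d := by ring
      rw [this]
      exact (((h5.mul_left _).sub (hs1.mul_left _)).sub (hs1'.mul_left _)).sub (dvd_refl _)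
    have := Int.eq_zero_of_abs_lt_dvd h6 (by rw [abs_lt]; omega)
    omega

theorem sum_beattyIndicator_ne_zero {p r : ℤ} {d n : ℕ} (hp : 0 < p) (hpd : p < d)
    (hc : IsCoprime p d) (hn : n ≠ 0) (hdn : d ∣ n) {ζ : ℂ} (hζ : IsPrimitiveRoot ζ d) :
    ∑ x ∈ range n, beattyIndicator p d r x * ζ ^ (x : ℤ) ≠ 0 := by
  obtain ⟨s, b, hs⟩ := hc
  have h := norm_sum_beattyIndicator (r := r) hp hpd (s := s) ⟨-b, by linarith⟩ hdn hζ
  intro h0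
  rw [h0, norm_zero, mul_zero, eq_comm, mul_eq_zero, norm_eq_zero, sub_eq_zero,
    Nat.cast_eq_zero, card_eq_zero] at h
  rcases h with h | h
  · exact notMem_empty 0 (h ▸ mem_filter.mpr ⟨mem_range.mpr (Nat.pos_of_ne_zero hn), dvd_zero d⟩)
  · exact hζ.ne_one (by omega) h

/-- In a covering by Beatty sequences with slopes `g k * p k / (g k * d k)`, a reduced denominator
that is maximal for divisibility occurs at least three times. -/
theorem three_le_card_of_maximal_denominator {ι : Type*} [Fintype ι] {n : ℕ} (hn : n ≠ 0)
    {p r : ι → ℤ} {g d : ι → ℕ} (hgd : ∀ k, g k * d k = n)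
    (hp : ∀ k, 0 < p k ∧ p k < d k) (hcop : ∀ k, IsCoprime (p k) (d k))
    (hinj : Function.Injective fun k => g k * p k)
    (hpair : ∀ i j, i ≠ j → g i * p i + g j * p j ≠ n)
    {c : ℕ} (hcover : ∀ x : ℤ, ∑ k, beattyCount (g k * p k) n (r k) x = c)
    (k : ι) (hmax : ∀ j, d k ∣ d j → d j = d k) :
    3 ≤ #{j | d j = d k} := by
  have hg (j : ι) : 0 < g j := Nat.pos_of_ne_zero fun h => hn (by rw [← hgd j, h, zero_mul])
  have hdn (j : ι) : d j ∣ n := ⟨g j, by rw [mul_comm, hgd]⟩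
  have hd0 : d k ≠ 0 := by have := hp k; omega
  have hd1 : 1 < d k := by have := hp k; omega
  obtain ⟨ζ, hζ⟩ : ∃ ζ : ℂ, IsPrimitiveRoot ζ (d k) := ⟨_, Complex.isPrimitiveRoot_exp _ hd0⟩
  have hζn : ζ ^ n = 1 := (hζ.pow_eq_one_iff_dvd n).mpr (hdn k)
  let S (j : ι) : ℂ := ∑ x ∈ range n, beattyIndicator (p j) (d j) (r j) x * ζ ^ (x : ℤ)
  have hsum : ∑ j, S j = 0 := by
    have hx (x : ℤ) : ∑ j, beattyIndicator (p j) (d j) (r j) x = (c : ℂ) := by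
      rw [← hcover x, Nat.cast_sum]
      refine sum_congr rfl fun j _ => ?_
      rw [← beattyCount_mul_mul (Nat.cast_pos.mpr (hg j)) (hp j).1 (hp j).2, ← hgd j, Nat.cast_mul]
    simp only [S]
    rw [sum_comm]
    simp only [← sum_mul, hx, ← mul_sum, zpow_natCast]
    have hgeom := mul_geom_sum ζ n
    rw [hζn, sub_self, mul_eq_zero, sub_eq_zero] at hgeom
    rw [hgeom.resolve_left (hζ.ne_one hd1), mul_zero]
  have hzero (j : ι) (hj : d j ≠ d k) : S j = 0 :=
    sum_beattyIndicator_eq_zero _ _ (hdn j) (hζ.ne_zero hd0) hζn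
      fun h => hj (hmax j ((hζ.pow_eq_one_iff_dvd _).mp h))
  have hne (j : ι) (hj : d j = d k) : S j ≠ 0 :=
    sum_beattyIndicator_ne_zero (hp j).1 (hp j).2 (hcop j) hn (hdn j) (hj ▸ hζ)
  have hA : ∑ j with d j = d k, S j = 0 := by
    rw [← hsum]
    refine sum_subset (subset_univ _) fun j _ hj => hzero j fun h => hj (by simpa using h)
  by_contra! hcard
  have hk : k ∈ ({j | d j = d k} : Finset ι) := by simp
  have hpos : 0 < #{j | d j = d k} := card_pos.mpr ⟨k, hk⟩
  obtain h | h : #{j | d j = d k} = 1 ∨ #{j | d j = d k} = 2 := by omega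
  · obtain ⟨j, hj⟩ := card_eq_one.mp h
    have hjd : d j = d k := by
      have : j ∈ ({j | d j = d k} : Finset ι) := by rw [hj]; simp
      simpa using this
    rw [hj, sum_singleton] at hA
    exact hne j hjd hA
  · classical
    obtain ⟨i, j, hij, hA'⟩ := card_eq_two.mp h
    have hi : d i = d k := by
      have : i ∈ ({j | d j = d k} : Finset ι) := by rw [hA']; simp
      simpa using this
    have hj : d j = d k := by
      have : j ∈ ({j | d j = d k} : Finset ι) := by rw [hA']; simp
      simpa using this
    have hgij : g i = g j := by
      apply Nat.eq_of_mul_eq_mul_right (Nat.pos_of_ne_zero hd0)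
      conv_lhs => rw [← hi, hgd]
      rw [← hj, hgd]
    rw [hA', sum_pair hij] at hA
    have hni := hne i hi
    have hdij : d j = d i := hj.trans hi.symm
    simp only [S, hdij] at hA hni
    rcases eq_or_add_eq_of_sum_beattyIndicator_add_eq_zero (hp i).1 (hp i).2 (hp j).1
      (hdij ▸ (hp j).2) (hcop i) (hdij ▸ hcop j) (hdn i) (hi ▸ hζ) hni hA with h' | h'
    · exact hij (hinj (by simp only [hgij, h']))
    · apply hpair i j hij
      rw [← hgij, ← mul_add, h', ← hgd i, Nat.cast_mul]

theorem min_gcd_eq_one (q : ℤ) (hq : 1 < q) (m : ℕ) (hm : m ≤ 5) (p r : Fin m → ℤ)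
    (hpinj : Function.Injective p)
    (hp : ∀ k, 0 < p k ∧ p k < q)
    (hgcd : Finset.univ.gcd (fun k => Int.gcd (p k) q) = 1)
    (hpair : ∀ i j : Fin m, i ≠ j → p i + p j ≠ q)
    (c : ℕ) (hc : 0 < c)
    (hcover : ∀ x : ℤ, ∑ k, beattyCount (p k) q (r k) x = c) :
    ∃ k, Int.gcd (p k) q = 1 := by
  lift q to ℕ using by omega
  have hq0 : q ≠ 0 := by omega
  set g : Fin m → ℕ := fun k => Int.gcd (p k) q with hg
  have hgpos (k : Fin m) : 0 < g k := Int.gcd_pos_of_ne_zero_left _ (hp k).1.ne'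
  have hred (k : Fin m) : ∃ (a : ℤ) (d : ℕ), g k * a = p k ∧ g k * d = q ∧ IsCoprime a d := by
    obtain ⟨a, b, hab, ha, hb⟩ := Int.exists_gcd_one (hgpos k)
    have hb0 : 0 ≤ b := by
      by_contra! h
      have : (0 : ℤ) < g k := by exact_mod_cast hgpos k
      nlinarith
    lift b to ℕ using hb0
    refine ⟨a, b, by rw [ha, mul_comm], ?_, Int.isCoprime_iff_gcd_eq_one.mpr hab⟩
    rw [mul_comm]
    exact_mod_cast hb.symm
  choose a d ha hd hcop using hred
  have had (k : Fin m) : 0 < a k ∧ a k < d k := by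
    have h0 : (0 : ℤ) < g k := by exact_mod_cast hgpos k
    have h := hp k
    rw [← ha, ← hd k, Nat.cast_mul] at h
    exact ⟨(mul_pos_iff_of_pos_left h0).mp h.1, lt_of_mul_lt_mul_left h.2 h0.le⟩
  have hcard (k : Fin m) (hmax : ∀ j, d k ∣ d j → d j = d k) : 3 ≤ #{j | d j = d k} :=
    three_le_card_of_maximal_denominator hq0 hd had hcop (by simpa only [ha] using hpinj)
      (by simpa only [ha] using hpair) (by simpa only [ha] using hcover) k hmax
  have hm0 : (univ : Finset (Fin m)).Nonempty := by
    by_contra h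
    rw [not_nonempty_iff_eq_empty] at h
    simp [h] at hgcd
  obtain ⟨k, -, hk⟩ := exists_max_image univ d hm0
  have hdpos (j : Fin m) : 0 < d j := by have := had j; omega
  have hk3 := hcard k fun j hj => le_antisymm (hk j (mem_univ j)) (Nat.le_of_dvd (hdpos j) hj)
  by_cases hall : ∀ j, d j ∣ d k
  · refine ⟨k, Nat.dvd_one.mp (hgcd ▸ Finset.dvd_gcd fun j _ => ?_)⟩
    obtain ⟨e, he⟩ := hall j
    refine ⟨e, Nat.eq_of_mul_eq_mul_right (hdpos j) ?_⟩
    change g j * d j = g k * e * d j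
    rw [hd, ← hd k, he]
    ring
  · push Not at hall
    obtain ⟨l, hl, hlmax⟩ := exists_max_image {j | ¬ d j ∣ d k} d
      (by simpa [Finset.Nonempty] using hall)
    simp only [mem_filter, mem_univ, true_and] at hl hlmax
    have hl3 := hcard l fun j hj =>
      le_antisymm (hlmax j fun h => hl (hj.trans h)) (Nat.le_of_dvd (hdpos j) hj)
    have hdisj : Disjoint ({j | d j = d k} : Finset (Fin m)) ({j | d j = d l} : Finset (Fin m)) := by
      rw [disjoint_filter]
      intro j _ h1 h2
      exact hl (by rw [← h2, h1])
    have h := card_le_univ (({j | d j = d k} : Finset (Fin m)).disjUnion _ hdisj)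
    rw [card_disjUnion, Fintype.card_fin] at h
    omega
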